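/- arXiv:math/0305133 — 2 statements merged into one kernel-verified Lean document; each statement's English description precedes it below -/
import Mathlib

section
/- Suppose α, β, α′, β′ are real with α+β = 1, and B(α,α′) and B(β,β′) tile ℕ. If k is an integer with kα+α′ > 0 and kβ+β′ > 0, and neither kα+α′ nor kβ+β′ is an integer, then {kα+α′} + {kβ+β′} = α′ + β′ + 1, where {x} denotes the fractional part of x. -/
/-- The Beatty sequence `B(α,α') = (⌊(n-α')/α⌋)_{n ≥ 1}`, as a set of integers. -/
def beatty (α α' : ℝ) : Set ℤ := {k | ∃ n : ℕ, 1 ≤ n ∧ k = ⌊((n : ℝ) - α') / α⌋}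

/-- Two sets of integers tile ℕ if they are disjoint and their union is the positive integers. -/
def TilesN (S T : Set ℤ) : Prop := Disjoint S T ∧ S ∪ T = {n : ℤ | 1 ≤ n}

theorem pos_of_beatty_subset_pos {α α' : ℝ} (h : ∀ x ∈ beatty α α', 1 ≤ x) : 0 < α := by
  by_contra! hα
  obtain ⟨n, hn⟩ := exists_nat_ge (max 1 α')
  have hn1 : (1 : ℝ) ≤ n := (le_max_left _ _).trans hn
  have hn2 : α' ≤ n := (le_max_right _ _).trans hn
  have h1 := h _ ⟨n, by exact_mod_cast hn1, rfl⟩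
  have h2 : ((n : ℝ) - α') / α ≤ 0 :=
    div_nonpos_of_nonneg_of_nonpos (by linarith) hα
  have h3 : ((1 : ℤ) : ℝ) ≤ ((n : ℝ) - α') / α := Int.le_floor.1 h1
  push_cast at h3
  linarith

/-- The elements of `beatty α α'` below `m` form a finite set with `⌈m * α + α'⌉ - 1` elements. -/
theorem exists_finset_beatty_lt {α : ℝ} (α' : ℝ) (h0 : 0 < α) (h1 : α < 1) (m : ℤ)
    (hm : 0 < (m : ℝ) * α + α') :
    ∃ s : Finset ℤ, (∀ x, x ∈ s ↔ x ∈ beatty α α' ∧ x < m) ∧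
      (s.card : ℤ) = ⌈(m : ℝ) * α + α'⌉ - 1 := by
  have hmono : StrictMono fun n : ℤ => ⌊((n : ℝ) - α') / α⌋ := by
    refine strictMono_int_of_lt_succ fun n => ?_
    refine Int.lt_of_add_one_le (Int.le_floor.2 ?_)
    have h2 := Int.floor_le (((n : ℝ) - α') / α)
    have h3 : (((n + 1 : ℤ) : ℝ) - α') / α = ((n : ℝ) - α') / α + 1 / α := by
      push_cast; ring
    have h4 : 1 < 1 / α := (one_lt_div h0).2 h1
    rw [h3]
    push_cast
    linarith
  have hlt : ∀ n : ℤ, ⌊((n : ℝ) - α') / α⌋ < m ↔ n < ⌈(m : ℝ) * α + α'⌉ := fun n => by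
    rw [Int.floor_lt, Int.lt_ceil, div_lt_iff₀ h0, sub_lt_iff_lt_add]
  refine ⟨(Finset.Ico 1 ⌈(m : ℝ) * α + α'⌉).image fun n : ℤ => ⌊((n : ℝ) - α') / α⌋, ?_, ?_⟩
  · intro x
    simp only [Finset.mem_image, Finset.mem_Ico, beatty, Set.mem_ofPred_eq]
    constructor
    · rintro ⟨n, ⟨hn1, hn2⟩, rfl⟩
      lift n to ℕ using by omega
      exact ⟨⟨n, by omega, by simp⟩, (hlt _).2 hn2⟩
    · rintro ⟨⟨n, hn, rfl⟩, hx⟩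
      exact ⟨n, ⟨by omega, (hlt n).1 (by simpa using hx)⟩, by simp⟩
  · rw [Finset.card_image_of_injective _ hmono.injective, Int.card_Ico, Int.toNat_of_nonneg]
    have := Int.ceil_pos.2 hm
    omega

theorem ceil_add_ceil_of_tilesN {α β α' β' : ℝ} (hα : 0 < α) (hβ : 0 < β) (hab : α + β = 1)
    (ht : TilesN (beatty α α') (beatty β β')) (m : ℤ) (hm : 1 ≤ m)
    (hma : 0 < (m : ℝ) * α + α') (hmb : 0 < (m : ℝ) * β + β') :
    ⌈(m : ℝ) * α + α'⌉ + ⌈(m : ℝ) * β + β'⌉ = m + 1 := by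
  obtain ⟨s, hs, hsc⟩ := exists_finset_beatty_lt α' hα (by linarith) m hma
  obtain ⟨t, ht', htc⟩ := exists_finset_beatty_lt β' hβ (by linarith) m hmb
  have hdisj : Disjoint s t := Finset.disjoint_left.2 fun x hx hy =>
    Set.disjoint_left.1 ht.1 ((hs x).1 hx).1 ((ht' x).1 hy).1
  have hunion : s ∪ t = Finset.Ico 1 m := by
    ext x
    have := Set.ext_iff.1 ht.2 x
    simp only [Set.mem_union, Set.mem_ofPred_eq] at this
    rw [Finset.mem_union, hs, ht', Finset.mem_Ico, ← this]
    tauto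
  have hcard := Finset.card_union_of_disjoint hdisj
  rw [hunion, Int.card_Ico] at hcard
  omega

/-- The offsets of two tiling Beatty sequences of complementary slopes are not both positive. -/
theorem not_offsets_pos_of_tilesN {α β α' β' : ℝ} (hα : 0 < α) (hβ : 0 < β) (hab : α + β = 1)
    (ht : TilesN (beatty α α') (beatty β β')) (ha' : 0 < α') (hb' : 0 < β') : False := by
  have first_le {γ γ' : ℝ} (hγ : 0 < γ) (h : ∀ x ∈ beatty γ γ', 1 ≤ x) : γ' ≤ 1 - γ := by
    have h1 := Int.le_floor.1 (h _ ⟨1, le_rfl, rfl⟩)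
    rw [le_div_iff₀ hγ] at h1
    push_cast at h1
    linarith
  have ha1 := first_le hα fun x hx => ht.2.subset (Or.inl hx)
  have hb1 := first_le hβ fun x hx => ht.2.subset (Or.inr hx)
  obtain ⟨ε, hε, hε'⟩ : ∃ ε : ℝ, 0 < ε ∧ ε < min (min α' β') (min α β) :=
    exists_between (by simp [*])
  simp only [lt_min_iff] at hε'
  obtain ⟨N, hN⟩ := exists_nat_one_div_lt hε
  obtain ⟨m, hm0, -, hm⟩ := Real.exists_nat_abs_mul_sub_round_le α N.succ_pos
  have hle : (1 : ℝ) / ((N.succ : ℕ) + 1) ≤ 1 / (N + 1) := by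
    apply one_div_le_one_div_of_le <;> push_cast <;> linarith [(Nat.cast_nonneg N : (0 : ℝ) ≤ N)]
  obtain ⟨h1, h2⟩ := abs_le.1 (hm.trans (hle.trans hN.le))
  have hm0' : (0 : ℝ) < m := by exact_mod_cast hm0
  set p := round ((m : ℝ) * α)
  have hmb : (m : ℝ) * β = m - m * α := by rw [← eq_sub_iff_add_eq'] at hab; rw [hab]; ring
  have key := ceil_add_ceil_of_tilesN hα hβ hab ht m (by omega)
    (by push_cast; positivity) (by push_cast; positivity)
  have hca : ⌈((m : ℤ) : ℝ) * α + α'⌉ = p + 1 := by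
    rw [Int.ceil_eq_iff]; push_cast
    constructor <;> linarith
  have hcb : ⌈((m : ℤ) : ℝ) * β + β'⌉ = m - p + 1 := by
    rw [Int.ceil_eq_iff]; push_cast; rw [hmb]
    constructor <;> linarith
  omega

theorem stmt7 (α β α' β' : ℝ) (hab : α + β = 1)
    (ht : TilesN (beatty α α') (beatty β β'))
    (k : ℤ) (hka : 0 < (k : ℝ) * α + α') (hkb : 0 < (k : ℝ) * β + β')
    (hna : ¬ ∃ z : ℤ, (k : ℝ) * α + α' = (z : ℝ))
    (hnb : ¬ ∃ z : ℤ, (k : ℝ) * β + β' = (z : ℝ)) :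
    Int.fract ((k : ℝ) * α + α') + Int.fract ((k : ℝ) * β + β') = α' + β' + 1 := by
  have hα : 0 < α := pos_of_beatty_subset_pos fun x hx => ht.2.subset (Or.inl hx)
  have hβ : 0 < β := pos_of_beatty_subset_pos fun x hx => ht.2.subset (Or.inr hx)
  have hk : 1 ≤ k := by
    by_contra! hk
    have hk' : (k : ℝ) ≤ 0 := by exact_mod_cast Int.lt_add_one_iff.1 hk
    have h1 := mul_nonpos_of_nonpos_of_nonneg hk' hα.le
    have h2 := mul_nonpos_of_nonpos_of_nonneg hk' hβ.le
    exact not_offsets_pos_of_tilesN hα hβ hab ht (by linarith) (by linarith)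
  have ceil_eq {x : ℝ} (hx : ¬ ∃ z : ℤ, x = (z : ℝ)) : ⌈x⌉ = ⌊x⌋ + 1 := by
    rw [Int.ceil_eq_iff]
    push_cast
    have := lt_of_le_of_ne (Int.floor_le x) fun h => hx ⟨_, h.symm⟩
    exact ⟨by linarith, (Int.lt_floor_add_one x).le⟩
  have key := ceil_add_ceil_of_tilesN hα hβ hab ht k hk hka hkb
  rw [ceil_eq hna, ceil_eq hnb] at key
  have key' : (⌊(k : ℝ) * α + α'⌋ : ℝ) + 1 + (⌊(k : ℝ) * β + β'⌋ + 1) = k + 1 := by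
    exact_mod_cast key
  have hsum : (k : ℝ) * α + k * β = k := by rw [← mul_add, hab, mul_one]
  unfold Int.fract
  linarith
end

section
/- Suppose α, β > 0 with α + β = 1, α = a/q rational in lowest terms with q ≥ 3 and α ≠ 1/2, and suppose B(α,α′) and B(β,β′) tile ℕ where α′ = a′/q and β′ = b′/q are rationals with denominator q. Then β′ ≡ −α′ + 1/q (mod 1), i.e., α′ + β′ − 1/q ∈ ℤ. -/
/-- For a rational slope and offset with common denominator, membership in a Beatty sequence
is a condition on integers. -/
theorem mem_beatty_div_iff {c q : ℝ} (hc : 0 < c) (hq : 0 < q) (c' : ℝ) (k : ℤ) :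
    k ∈ beatty (c / q) (c' / q) ↔
      ∃ n : ℕ, 1 ≤ n ∧ c * k + c' ≤ q * n ∧ q * n < c * k + c' + c := by
  refine exists_congr fun n => and_congr_right fun _ => ?_
  have h : ((n : ℝ) - c' / q) / (c / q) = (q * n - c') / c := by
    field_simp
  rw [h, eq_comm, Int.floor_eq_iff, le_div_iff₀ hc, div_lt_iff₀ hc]
  constructor <;> rintro ⟨h₁, h₂⟩ <;> constructor <;> linarith

/-- A linear congruence with invertible slope has solutions `k` whose quotient `m` and
difference `k - m` are both arbitrarily large. -/
theorem exists_large_mul_eq {a q : ℤ} (ha : 0 < a) (haq : a < q)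
    (hcop : IsCoprime a q) (y N : ℤ) :
    ∃ k m : ℤ, a * k = q * m + y ∧ N ≤ m ∧ N ≤ k - m := by
  obtain ⟨u, v, huv⟩ := hcop
  set t : ℤ := |N + y * v| + |N - (y * u + y * v)| with ht
  have h₁ : N + y * v ≤ t := (le_abs_self _).trans (le_add_of_nonneg_right (abs_nonneg _))
  have h₂ : N - (y * u + y * v) ≤ t :=
    (le_abs_self _).trans (le_add_of_nonneg_left (abs_nonneg _))
  have h₀ : 0 ≤ t := add_nonneg (abs_nonneg _) (abs_nonneg _)
  refine ⟨y * u + q * t, a * t - y * v, ?_, ?_, ?_⟩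
  · linear_combination y * huv
  · nlinarith
  · nlinarith

/-- If `α = a/q ∈ (0,1)` in lowest terms with `q ≥ 3` and `α ≠ 1/2`, the offsets are
rationals with denominator `q`, and `B(α,α')`, `B(1-α,β')` tile ℕ, then
`α' + β' ≡ 1/q (mod 1)`. -/
theorem stmt18 (a q : ℕ) (a' b' : ℤ) (α' β' : ℝ)
    (hq : 3 ≤ q) (ha : 0 < a) (haq : a < q) (hcop : Nat.Coprime a q)
    (hne : (a : ℝ) / q ≠ 1 / 2)
    (hα' : α' = (a' : ℝ) / q) (hβ' : β' = (b' : ℝ) / q)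
    (ht : TilesN (beatty ((a : ℝ) / q) α') (beatty (1 - (a : ℝ) / q) β')) :
    ∃ z : ℤ, α' + β' - 1 / (q : ℝ) = (z : ℝ) := by
  have hq0 : (0 : ℝ) < q := by exact_mod_cast (by omega : 0 < q)
  have ha0 : (0 : ℝ) < a := by exact_mod_cast ha
  have hb0 : (0 : ℝ) < q - a := sub_pos.2 (by exact_mod_cast haq)
  have hb : 1 - (a : ℝ) / q = (q - a) / q := by field_simp
  rw [hb, hα', hβ'] at ht
  obtain ⟨hdisj, hunion⟩ := ht
  have mem_left (k : ℤ) : k ∈ beatty ((a : ℝ) / q) (a' / q) ↔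
      ∃ n : ℕ, 1 ≤ n ∧ a * k + a' ≤ q * n ∧ (q : ℤ) * n < a * k + a' + a := by
    rw [mem_beatty_div_iff ha0 hq0]
    exact_mod_cast Iff.rfl
  have mem_right (k : ℤ) : k ∈ beatty (((q : ℝ) - a) / q) (b' / q) ↔
      ∃ n : ℕ, 1 ≤ n ∧ ((q : ℤ) - a) * k + b' ≤ q * n ∧
        (q : ℤ) * n < (q - a) * k + b' + (q - a) := by
    rw [mem_beatty_div_iff hb0 hq0]
    exact_mod_cast Iff.rfl
  have haz : (0 : ℤ) < a := by omega
  have hqz : (0 : ℤ) < q := by omega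
  have haqz : (a : ℤ) < q := by omega
  have hcopz : IsCoprime (a : ℤ) q := Nat.isCoprime_iff_coprime.2 hcop
  obtain ⟨k, m, hkm, hm, hk⟩ := exists_large_mul_eq haz haqz hcopz (1 - a') 1
  have hkl : k ∉ beatty ((a : ℝ) / q) (a' / q) := by
    rw [mem_left]
    rintro ⟨n, -, h₁, h₂⟩
    have h₃ : m < n := lt_of_mul_lt_mul_left (by linarith : (q : ℤ) * m < q * n) hqz.le
    have h₄ : (n : ℤ) < m + 1 :=
      lt_of_mul_lt_mul_left (by linarith : (q : ℤ) * n < q * (m + 1)) hqz.le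
    omega
  have hkr : k ∈ beatty (((q : ℝ) - a) / q) (b' / q) :=
    (hunion.ge (show (1 : ℤ) ≤ k by omega)).resolve_left hkl
  obtain ⟨n, -, h₁, h₂⟩ := (mem_right k).1 hkr
  obtain ⟨l, p, hlp, hp, hd⟩ := exists_large_mul_eq haz haqz hcopz (-a') (1 + |n - (k - m)|)
  have hn := neg_abs_le ((n : ℤ) - (k - m))
  have hll : l ∈ beatty ((a : ℝ) / q) (a' / q) := by
    have hp1 : 1 ≤ p := by linarith [abs_nonneg ((n : ℤ) - (k - m))]
    lift p to ℕ using by omega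
    exact (mem_left l).2 ⟨p, by omega, by linarith, by linarith⟩
  have hlr := Set.disjoint_left.1 hdisj hll
  have hs : a' + b' - 1 = q * (n - (k - m)) := by
    by_contra hs
    have hlt : a' + b' - 1 < q * (n - (k - m)) := lt_of_le_of_ne (by linarith) hs
    obtain ⟨j, hj⟩ : ∃ j : ℕ, (j : ℤ) = n - (k - m) + (l - p) :=
      ⟨_, Int.toNat_of_nonneg (by omega)⟩
    refine hlr ((mem_right l).2 ⟨j, by omega, ?_, ?_⟩) <;> rw [hj] <;> linarith
  refine ⟨n - (k - m), ?_⟩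
  have hs' : (a' : ℝ) + b' - 1 = q * ((n - (k - m) : ℤ) : ℝ) := by exact_mod_cast hs
  rw [hα', hβ', ← add_div, ← sub_div, hs', mul_div_cancel_left₀ _ hq0.ne']
end
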